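/- arXiv:2410.11502 — 2 statements merged into one kernel-verified Lean document; each statement's English description precedes it below -/
import Mathlib

section
/- Let N ≥ 2, let y : Fin N → ℝ be injective, and let ŷ = h ∘ y where h : ℝ → ℝ is order-preserving. Then AUPCC = (N−1)/N; that is, an order-preserving surrogate attains the maximal possible AUPCC value. -/
open Finset

/-- The top-`k` index set of scores `y : Fin N → ℝ`: the set of indices `i` such that the
number of indices `j` with `y j > y i` is strictly less than `k`. -/
noncomputable def topk {N : ℕ} (y : Fin N → ℝ) (k : ℕ) : Finset (Fin N) :=
  Finset.univ.filter fun i => (Finset.univ.filter fun j => y i < y j).card < k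

/-- `Precision@k` for predicted scores `yhat` against true scores `y`:
`|topk yhat k ∩ topk y k| / k`. -/
noncomputable def precisionAt {N : ℕ} (y yhat : Fin N → ℝ) (k : ℕ) : ℝ :=
  ((topk yhat k ∩ topk y k).card : ℝ) / k

theorem topk_card_aux {N : ℕ} (y : Fin N → ℝ) (hy : Function.Injective y) (k : ℕ) (hk : k ≤ N) :
    (topk y k).card = k := by
  classical
  have hlt : ∀ i, (Finset.univ.filter fun j => y i < y j).card < N := by
    intro i
    have h1 : (Finset.univ.filter fun j => y i < y j) ⊂ Finset.univ := by
      rw [Finset.ssubset_univ_iff]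
      intro h2
      have h3 := Finset.mem_univ i
      rw [← h2] at h3
      simp at h3
    have h4 := Finset.card_lt_card h1
    simpa using h4
  have hmono : ∀ a b, y a < y b → (Finset.univ.filter fun j => y b < y j).card <
      (Finset.univ.filter fun j => y a < y j).card := by
    intro a b hab
    apply Finset.card_lt_card
    rw [Finset.ssubset_iff_of_subset]
    · exact ⟨b, by simpa using hab, by simp⟩
    · intro j hj
      simp only [Finset.mem_filter, Finset.mem_univ, true_and] at hj ⊢
      exact hab.trans hj
  let r : Fin N → Fin N := fun i => ⟨_, hlt i⟩
  have hr : Function.Injective r := by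
    intro a b hab
    have hab' := congrArg Fin.val hab
    simp only [r] at hab'
    rcases lt_trichotomy (y a) (y b) with h1 | h1 | h1
    · have := hmono _ _ h1
      omega
    · exact hy h1
    · have := hmono _ _ h1
      omega
  have hb : Function.Bijective r := Finite.injective_iff_bijective.mp hr
  have himg : (topk y k).image (fun i => (r i : ℕ)) = Finset.range k := by
    ext m
    simp only [topk, Finset.mem_image, Finset.mem_filter, Finset.mem_univ, true_and,
      Finset.mem_range]
    constructor
    · rintro ⟨i, hi, rfl⟩
      exact hi
    · intro hm
      obtain ⟨i, hi⟩ := hb.2 ⟨m, by omega⟩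
      have hi' : (r i : ℕ) = m := congrArg Fin.val hi
      refine ⟨i, ?_, hi'⟩
      rw [← hi'] at hm
      exact hm
  rw [← Finset.card_image_of_injective (topk y k) (Fin.val_injective.comp hr)]
  have := congrArg Finset.card himg
  simpa [Function.comp_def] using this

/-- For `N ≥ 2`, injective `y : Fin N → ℝ`, and `yhat = h ∘ y` with `h` order-preserving,
the AUPCC `Σ_{k=1}^{N−1} (1/N) · (Precision@(k+1) + Precision@k)/2` equals `(N−1)/N`:
an order-preserving surrogate attains the maximal possible AUPCC value. -/
theorem aupcc_eq_of_order_preserving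
    {N : ℕ} (hN : 2 ≤ N) (y : Fin N → ℝ) (hy : Function.Injective y)
    (h : ℝ → ℝ) (h_ord : ∀ y₁ y₂ : ℝ, y₁ < y₂ ↔ h y₁ < h y₂)
    (yhat : Fin N → ℝ) (hyhat : yhat = h ∘ y) :
    ∑ k ∈ Finset.Icc 1 (N - 1),
        (1 / (N : ℝ)) * ((precisionAt y yhat (k + 1) + precisionAt y yhat k) / 2)
      = ((N : ℝ) - 1) / N := by
  have htop : ∀ k, topk yhat k = topk y k := by
    intro k
    subst hyhat
    simp only [topk, Function.comp_apply, ← h_ord]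
  have hp : ∀ k, 1 ≤ k → k ≤ N → precisionAt y yhat k = 1 := by
    intro k h1 h2
    have hk : (k : ℝ) ≠ 0 := by
      have : k ≠ 0 := by omega
      exact_mod_cast this
    rw [precisionAt, htop, Finset.inter_self, topk_card_aux y hy k h2, div_self hk]
  have hs : ∀ k ∈ Finset.Icc 1 (N - 1),
      (1 / (N : ℝ)) * ((precisionAt y yhat (k + 1) + precisionAt y yhat k) / 2) = 1 / (N : ℝ) := by
    intro k hk
    rw [Finset.mem_Icc] at hk
    rw [hp (k + 1) (by omega) (by omega), hp k (by omega) (by omega)]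
    norm_num
  rw [Finset.sum_congr rfl hs, Finset.sum_const, Nat.card_Icc, nsmul_eq_mul,
    Nat.add_sub_cancel, Nat.cast_sub (by omega)]
  simp [div_eq_mul_inv]
end

section
/- For every m ≥ 1 and all vectors y, ŷ ∈ ℝ^m, equality l_ListNet(y, ŷ) = l_ListNet(y, y) holds if and only if there exists a constant c ∈ ℝ such that ŷ_j = y_j + c for all j ∈ {1, …, m}. -/
open Finset

/-- The ListNet loss:
`l(y, s) = −Σ_j (exp(y_j)/Σ_i exp(y_i)) · log(exp(s_j)/Σ_i exp(s_i))`. -/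
noncomputable def listNetLoss {m : ℕ} (y s : Fin m → ℝ) : ℝ :=
  -∑ j, (Real.exp (y j) / ∑ i, Real.exp (y i)) *
      Real.log (Real.exp (s j) / ∑ i, Real.exp (s i))

/-- For every `m ≥ 1` and all vectors `y, yhat : Fin m → ℝ`, equality
`l(y, yhat) = l(y, y)` holds if and only if `yhat` is a constant shift of `y`. -/
theorem listNetLoss_eq_self_iff {m : ℕ} (hm : 1 ≤ m) (y yhat : Fin m → ℝ) :
    listNetLoss y yhat = listNetLoss y y ↔ ∃ c : ℝ, ∀ j : Fin m, yhat j = y j + c := by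
  haveI : Nonempty (Fin m) := ⟨⟨0, hm⟩⟩
  unfold listNetLoss
  have hpos : ∀ s : Fin m → ℝ, 0 < ∑ i, Real.exp (s i) := fun s =>
    Finset.sum_pos (fun i _ => Real.exp_pos _) Finset.univ_nonempty
  have hlog : ∀ (s : Fin m → ℝ) (j : Fin m),
      Real.log (Real.exp (s j) / ∑ i, Real.exp (s i))
        = s j - Real.log (∑ i, Real.exp (s i)) := fun s j => by
    rw [Real.log_div (Real.exp_pos _).ne' (hpos s).ne', Real.log_exp]
  simp only [hlog]
  have hZ := hpos y
  have hW := hpos yhat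
  constructor
  · intro h
    set Z := ∑ i, Real.exp (y i) with hZd
    set W := ∑ i, Real.exp (yhat i) with hWd
    let d : Fin m → ℝ := fun j => (yhat j - Real.log W) - (y j - Real.log Z)
    have hp : ∀ j, 0 < Real.exp (y j) / Z := fun j => div_pos (Real.exp_pos _) hZ
    have h1 : ∑ j, Real.exp (y j) / Z = 1 := by
      rw [← Finset.sum_div, ← hZd, div_self hZ.ne']
    have h2 : ∑ j, Real.exp (yhat j) / W = 1 := by
      rw [← Finset.sum_div, ← hWd, div_self hW.ne']
    have h3 : ∑ j, Real.exp (y j) / Z * d j = 0 := by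
      simp only [d, mul_sub _ (yhat _ - Real.log W), Finset.sum_sub_distrib]
      linarith
    have h4 : ∀ j, Real.exp (y j) / Z * Real.exp (d j) = Real.exp (yhat j) / W := by
      intro j
      simp only [d, Real.exp_sub, Real.exp_log hZ, Real.exp_log hW]
      have := (Real.exp_pos (y j)).ne'
      field_simp
    have h5 : ∑ j, Real.exp (y j) / Z * (Real.exp (d j) - (d j + 1)) = 0 := by
      simp only [mul_sub, mul_add, mul_one, h4, Finset.sum_sub_distrib, Finset.sum_add_distrib,
        h1, h2, h3]
      norm_num
    rw [Finset.sum_eq_zero_iff_of_nonneg (fun j _ =>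
      mul_nonneg (hp j).le (sub_nonneg.2 (Real.add_one_le_exp _)))] at h5
    refine ⟨Real.log W - Real.log Z, fun j => ?_⟩
    have hd : d j = 0 := by
      by_contra hne
      have := mul_pos (hp j) (sub_pos.2 (Real.add_one_lt_exp hne))
      exact this.ne' (h5 j (Finset.mem_univ j))
    simp only [d] at hd
    linarith
  · rintro ⟨c, hc⟩
    have hs : Real.log (∑ i, Real.exp (yhat i)) = Real.log (∑ i, Real.exp (y i)) + c := by
      simp only [hc, Real.exp_add]
      rw [← Finset.sum_mul, Real.log_mul hZ.ne' (Real.exp_pos _).ne', Real.log_exp]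
    rw [hs]
    congr 1
    refine Finset.sum_congr rfl fun j _ => ?_
    rw [hc j]
    ring
end
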